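/- arXiv:2210.12912 — 4 statements merged into one kernel-verified Lean document; each statement's English description precedes it below -/
import Mathlib

section
/- Let β > 0, σ > 0, and let (κ_n) be a sequence with κ_n → ∞. Suppose that for each n, γ_n > 0 satisfies F_{κ_n}(γ_n) = γ_n. Then γ_n → ∞ as n → ∞, and consequently the measures μ^{γ_n} converge weakly to the Dirac measure at 0, i.e. for every continuous 2π-periodic f : ℝ → ℝ, ∫_{−π}^{π} f(x) μ^{γ_n}(dx) → f(0). -/
open Real MeasureTheory Filter Topology

/-- Necessary second-order condition at a local minimum. -/
theorem second_deriv_nonneg_of_isLocalMin {f g : ℝ → ℝ} {x c : ℝ}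
    (hmin : IsLocalMin f x) (hf : ∀ y, HasDerivAt f (g y) y) (hg : HasDerivAt g c x) :
    0 ≤ c := by
  by_contra! hc
  have hdf : deriv f = g := funext fun y => (hf y).deriv
  have hmax : IsLocalMax f x := by
    apply isLocalMax_of_deriv_deriv_neg
    · rw [hdf, hg.deriv]; exact hc
    · rw [hdf]; exact hmin.hasDerivAt_eq_zero (hf x)
    · exact (hf x).continuousAt
  have hconst : f =ᶠ[𝓝 x] fun _ => f x := by
    filter_upwards [hmin, hmax] with y h1 h2 using le_antisymm h2 h1
  have h2 : deriv f =ᶠ[𝓝 x] fun _ => 0 := by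
    simpa using hconst.deriv
  have h3 := h2.deriv_eq
  rw [hdf, hg.deriv] at h3
  simp at h3
  exact hc.ne h3

section DerivativeEquation

variable {β a γ : ℝ} {u p : ℝ → ℝ}

/-- A solution of `β u - a u'' + u u' = γ sin` vanishing at `0` and `π` is positive between. -/
theorem pos_of_ode (hβ : 0 < β) (ha : 0 < a) (hγ : 0 < γ)
    (hu : ∀ x, HasDerivAt u (p x) x)
    (hp : ∀ x, HasDerivAt p ((β * u x + u x * p x - γ * sin x) / a) x)
    (h0 : u 0 = 0) (hpi : u π = 0) {y : ℝ} (hy : y ∈ Set.Ioo 0 π) : 0 < u y := by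
  have key : ∀ m ∈ Set.Ioo 0 π, IsMinOn u (Set.Icc 0 π) m → 0 < u m := by
    intro m hm hmin
    have hloc : IsLocalMin u m := hmin.isLocalMin (Icc_mem_nhds hm.1 hm.2)
    have h1 := hloc.hasDerivAt_eq_zero (hu m)
    have h2 := second_deriv_nonneg_of_isLocalMin hloc hu (hp m)
    rw [le_div_iff₀ ha, h1] at h2
    have h3 := mul_pos hγ (sin_pos_of_mem_Ioo hm)
    by_contra! h4
    nlinarith [mul_nonneg hβ.le (neg_nonneg.2 h4)]
  have hcont : Continuous u := continuous_iff_continuousAt.2 fun x => (hu x).continuousAt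
  obtain ⟨m, hm, hmin⟩ := isCompact_Icc.exists_isMinOn
    (Set.nonempty_Icc.2 pi_pos.le) hcont.continuousOn
  have hum : 0 ≤ u m := by
    by_cases hm0 : m = 0
    · rw [hm0, h0]
    by_cases hmpi : m = π
    · rw [hmpi, hpi]
    exact (key m ⟨lt_of_le_of_ne hm.1 (Ne.symm hm0), lt_of_le_of_ne hm.2 hmpi⟩ hmin).le
  have huy : 0 ≤ u y := hum.trans (hmin (Set.Ioo_subset_Icc_self hy))
  rcases huy.eq_or_lt with h | h
  · refine key y hy fun z hz => ?_
    change u y ≤ u z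
    rw [← h]
    exact hum.trans (hmin hz)
  · exact h

/-- Comparison of a solution of `β u - a u'' + u u' = γ sin` with a shifted sine. -/
theorem shifted_sin_le_of_ode (hβ : 0 < β) (ha : 0 < a) (hγ : 0 < γ)
    (hu : ∀ x, HasDerivAt u (p x) x)
    (hp : ∀ x, HasDerivAt p ((β * u x + u x * p x - γ * sin x) / a) x)
    (h0 : u 0 = 0) (hpi : u π = 0) {δ y : ℝ} (hδ : 0 < δ) (hy : y ∈ Set.Icc δ (π - δ)) :
    γ / (β + a + √γ) * (sin y - sin δ) ≤ u y := by
  have hpos : ∀ x ∈ Set.Icc δ (π - δ), 0 < u x := fun x hx =>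
    pos_of_ode hβ ha hγ hu hp h0 hpi ⟨by linarith [hx.1], by linarith [hx.2]⟩
  have hcont : Continuous u := continuous_iff_continuousAt.2 fun x => (hu x).continuousAt
  obtain ⟨m, hm, hmax⟩ := isCompact_Icc.exists_isMaxOn (f := fun x => (sin x - sin δ) / u x)
    ⟨y, hy⟩ (ContinuousOn.div (by fun_prop) hcont.continuousOn fun x hx => (hpos x hx).ne')
  set q := (sin m - sin δ) / u m with hq
  have hum := hpos m hm
  have hsq : 0 < √γ := sqrt_pos.2 hγ
  have hsq2 : √γ * √γ = γ := mul_self_sqrt hγ.le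
  have hB : 0 < β + a + √γ := by positivity
  have hqm : q * u m = sin m - sin δ := by rw [hq]; field_simp
  have hle : ∀ x ∈ Set.Icc δ (π - δ), sin x - sin δ ≤ q * u x := fun x hx =>
    (div_le_iff₀ (hpos x hx)).1 (hmax hx)
  have hqle : q * γ ≤ β + a + √γ := by
    by_contra! hlt
    have hq0 : 0 < q := pos_of_mul_pos_left (hB.trans hlt) hγ.le
    have hs : 0 < sin m - sin δ := hqm ▸ mul_pos hq0 hum
    have hmδ : m ≠ δ := by rintro rfl; simp at hs
    have hmδ' : m ≠ π - δ := by rintro rfl; simp [sin_pi_sub] at hs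
    have hmI : Set.Icc δ (π - δ) ∈ 𝓝 m :=
      Icc_mem_nhds (lt_of_le_of_ne hm.1 hmδ.symm) (lt_of_le_of_ne hm.2 hmδ')
    have hloc : IsLocalMin (fun x => q * u x - (sin x - sin δ)) m := by
      filter_upwards [hmI] with x hx
      linarith [hle x hx]
    have hz : ∀ x, HasDerivAt (fun x => q * u x - (sin x - sin δ)) (q * p x - cos x) x :=
      fun x => ((hu x).const_mul q).sub ((hasDerivAt_sin x).sub_const _)
    have h1 := hloc.hasDerivAt_eq_zero (hz m)
    have h2 := second_deriv_nonneg_of_isLocalMin hloc hz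
      (((hp m).const_mul q).sub (hasDerivAt_cos m))
    have hsd : 0 ≤ sin δ := sin_nonneg_of_nonneg_of_le_pi hδ.le (by linarith [hy.1, hy.2])
    have hsm : 0 < sin m := by linarith
    have h3 : 0 ≤ q * (β * u m + u m * p m - γ * sin m) + a * sin m := by
      have := mul_nonneg ha.le h2
      have e : a * (q * ((β * u m + u m * p m - γ * sin m) / a) - -sin m)
        = q * (β * u m + u m * p m - γ * sin m) + a * sin m := by field_simp; ring
      linarith
    have h4 : 0 ≤ (β * q + 1) * (sin m - sin δ) - γ * q ^ 2 * sin m + a * q * sin m := by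
      have h5 : q * p m = cos m := by linarith
      have h6 := mul_nonneg hq0.le h3
      have e : q * (q * (β * u m + u m * p m - γ * sin m) + a * sin m)
        = β * q * (q * u m) + (q * u m) * (q * p m) - γ * q ^ 2 * sin m + a * q * sin m := by
        ring
      rw [e, hqm, h5] at h6
      nlinarith [mul_nonneg hs.le (sub_nonneg.2 (cos_le_one m))]
    have h7 : 0 ≤ (β * q + 1 - γ * q ^ 2 + a * q) * sin m := by
      nlinarith [mul_nonneg (by positivity : 0 ≤ β * q + 1) hsd]
    have h8 : 0 ≤ β * q + 1 - γ * q ^ 2 + a * q := nonneg_of_mul_nonneg_left h7 hsm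
    have h9 := mul_lt_mul_of_pos_left hlt hq0
    have h10 : √γ * q < 1 := by nlinarith
    have h11 : √γ < √γ * (√γ * q) := by nlinarith
    nlinarith
  rw [div_mul_eq_mul_div, div_le_iff₀ hB]
  have := hle y hy
  nlinarith [mul_le_mul_of_nonneg_right hqle (hpos y hy).le, mul_le_mul_of_nonneg_left this hγ.le]

/-- A solution of `β u - a u'' + u u' = γ sin` vanishing at `0` and `π` dominates a multiple of
the sine on `[0, π]`. -/
theorem sin_le_of_ode (hβ : 0 < β) (ha : 0 < a) (hγ : 0 < γ)
    (hu : ∀ x, HasDerivAt u (p x) x)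
    (hp : ∀ x, HasDerivAt p ((β * u x + u x * p x - γ * sin x) / a) x)
    (h0 : u 0 = 0) (hpi : u π = 0) {y : ℝ} (hy : y ∈ Set.Icc 0 π) :
    γ / (β + a + √γ) * sin y ≤ u y := by
  by_cases hy0 : y = 0
  · simp [hy0, h0]
  by_cases hypi : y = π
  · simp [hypi, hpi]
  have hy1 : 0 < y := lt_of_le_of_ne hy.1 (Ne.symm hy0)
  have hy2 : 0 < π - y := sub_pos.2 (lt_of_le_of_ne hy.2 hypi)
  have hlim : Tendsto (fun δ => γ / (β + a + √γ) * (sin y - sin δ)) (𝓝[>] 0)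
      (𝓝 (γ / (β + a + √γ) * sin y)) := by
    have : Continuous fun δ => γ / (β + a + √γ) * (sin y - sin δ) := by fun_prop
    simpa using (this.tendsto 0).mono_left nhdsWithin_le_nhds
  refine le_of_tendsto hlim ?_
  filter_upwards [self_mem_nhdsWithin, nhdsWithin_le_nhds (Iio_mem_nhds hy1),
    nhdsWithin_le_nhds (Iio_mem_nhds hy2)] with δ h1 h2 h3
  exact shifted_sin_le_of_ode hβ ha hγ hu hp h0 hpi h1
    ⟨le_of_lt h2, by linarith [Set.mem_Iio.1 h3]⟩

end DerivativeEquation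

section HamiltonJacobi

variable {β a γ : ℝ} {v : ℝ → ℝ}

/-- Periodic solutions of the Hamilton–Jacobi equation with even right-hand side
are even. -/
theorem even_of_ode (hβ : 0 < β) (ha : 0 < a)
    (hper : Function.Periodic v (2 * π)) (hC2 : ContDiff ℝ 2 v)
    (hODE : ∀ x, β * v x - a * deriv (deriv v) x + (1 / 2) * (deriv v x) ^ 2 = -γ * cos x) :
    Function.Even v := by
  have hu : ∀ x, HasDerivAt v (deriv v x) x := fun x =>
    (hC2.differentiable (by norm_num) x).hasDerivAt
  have hp : ∀ x, HasDerivAt (deriv v) (deriv (deriv v) x) x := fun x =>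
    ((ContDiff.deriv' (n := 1) hC2).differentiable (by norm_num) x).hasDerivAt
  have hun : ∀ x, HasDerivAt (fun x => v (-x)) (-deriv v (-x)) x := fun x => by
    exact ((hu (-x)).comp x (hasDerivAt_neg x)).congr_deriv (by ring)
  have hpn : ∀ x, HasDerivAt (fun x => deriv v (-x)) (-deriv (deriv v) (-x)) x := fun x => by
    exact ((hp (-x)).comp x (hasDerivAt_neg x)).congr_deriv (by ring)
  have hz : ∀ x, HasDerivAt (fun x => v (-x) - v x) (-deriv v (-x) - deriv v x) x := fun x =>
    (hun x).sub (hu x)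
  have hcont : Continuous fun x => v (-x) - v x :=
    (hC2.continuous.comp continuous_neg).sub hC2.continuous
  have hzper : Function.Periodic (fun x => v (-x) - v x) (2 * π) := fun x => by
    have h1 := hper x
    have h2 := hper (-(x + 2 * π))
    simp only [neg_add, neg_add_cancel_right] at h2 ⊢
    rw [h1, h2]
  obtain ⟨m, -, hm⟩ := isCompact_Icc.exists_isMinOn
    (Set.nonempty_Icc.2 two_pi_pos.le) hcont.continuousOn
  have hmin : ∀ x, v (-m) - v m ≤ v (-x) - v x := fun x => by
    obtain ⟨y, hy, hxy⟩ := hzper.exists_mem_Ico₀ two_pi_pos x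
    exact (hm (Set.Ico_subset_Icc_self hy)).trans hxy.ge
  have hloc : IsLocalMin (fun x => v (-x) - v x) m := Eventually.of_forall hmin
  have h1 := hloc.hasDerivAt_eq_zero (hz m)
  have h2 := second_deriv_nonneg_of_isLocalMin hloc hz ((hpn m).neg.sub (hp m))
  have h3 := hODE m
  have h4 := hODE (-m)
  have h5 : deriv v (-m) = -deriv v m := by linarith
  rw [h5, cos_neg, neg_sq] at h4
  have h6 : 0 ≤ v (-m) - v m := by
    refine nonneg_of_mul_nonneg_right ?_ hβ
    nlinarith [mul_nonneg ha.le h2]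
  intro x
  have h7 := hmin x
  have h8 := hmin (-x)
  simp only [neg_neg] at h8
  linarith

/-- The derivative of the periodic solution has the sign of the sine, quantitatively. -/
theorem sin_sq_le_deriv_mul_sin (hβ : 0 < β) (ha : 0 < a) (hγ : 0 < γ)
    (hper : Function.Periodic v (2 * π)) (hC2 : ContDiff ℝ 2 v)
    (hODE : ∀ x, β * v x - a * deriv (deriv v) x + (1 / 2) * (deriv v x) ^ 2 = -γ * cos x)
    {x : ℝ} (hx : x ∈ Set.Icc (-π) π) :
    γ / (β + a + √γ) * sin x ^ 2 ≤ sin x * deriv v x := by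
  have hu : ∀ x, HasDerivAt v (deriv v x) x := fun x =>
    (hC2.differentiable (by norm_num) x).hasDerivAt
  have hp : ∀ x, HasDerivAt (deriv v) (deriv (deriv v) x) x := fun x =>
    ((ContDiff.deriv' (n := 1) hC2).differentiable (by norm_num) x).hasDerivAt
  have heven := even_of_ode hβ ha hper hC2 hODE
  have hodd : ∀ x, deriv v (-x) = -deriv v x := fun x => by
    have h1 : HasDerivAt (fun x => v (-x)) (-deriv v (-x)) x := by
      exact ((hu (-x)).comp x (hasDerivAt_neg x)).congr_deriv (by ring)
    have h2 : (fun x => v (-x)) = v := funext heven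
    rw [h2] at h1
    linarith [h1.unique (hu x)]
  have h0 : deriv v 0 = 0 := by
    have := hodd 0
    rw [neg_zero] at this
    linarith
  have hpi : deriv v π = 0 := by
    have h1 : HasDerivAt (fun x => v (x + 2 * π)) (deriv v (-π + 2 * π)) (-π) :=
      (hu _).comp_add_const _ _
    have h2 : (fun x => v (x + 2 * π)) = v := funext hper
    rw [h2] at h1
    have h3 := h1.unique (hu (-π))
    rw [hodd, show -π + 2 * π = π by ring] at h3
    linarith
  have hpeq : deriv (deriv v) = fun x =>
      (β * v x + (1 / 2) * (deriv v x) ^ 2 + γ * cos x) / a := funext fun x => by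
    rw [eq_div_iff ha.ne']
    linarith [hODE x]
  have hpp : ∀ x, HasDerivAt (deriv (deriv v))
      ((β * deriv v x + deriv v x * deriv (deriv v) x - γ * sin x) / a) x := fun x => by
    have h := ((((hu x).const_mul β).add (((hp x).pow 2).const_mul (1 / 2))).add
      ((hasDerivAt_cos x).const_mul γ)).div_const a
    rw [hpeq]
    rw [hpeq] at h
    refine h.congr_deriv ?_
    simp
    ring
  have key : ∀ y ∈ Set.Icc 0 π, γ / (β + a + √γ) * sin y ^ 2 ≤ sin y * deriv v y := fun y hy => by
    have h1 := mul_le_mul_of_nonneg_left (sin_le_of_ode hβ ha hγ hp hpp h0 hpi hy)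
      (sin_nonneg_of_mem_Icc hy)
    linarith
  rcases le_total 0 x with h | h
  · exact key x ⟨h, hx.2⟩
  · have := key (-x) ⟨by linarith, by linarith [hx.1]⟩
    rw [sin_neg, hodd] at this
    linarith

/-- Quantitative lower bound for the first cosine moment of the Gibbs density. -/
theorem integral_cos_mul_exp_ge (hβ : 0 < β) (ha : 0 < a) (hγ : 0 < γ)
    (hper : Function.Periodic v (2 * π)) (hC2 : ContDiff ℝ 2 v)
    (hODE : ∀ x, β * v x - a * deriv (deriv v) x + (1 / 2) * (deriv v x) ^ 2 = -γ * cos x)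
    {c : ℝ} (hc : 0 < c) :
    c * γ * ∫ x in (-π)..π, exp (-c * v x) ≤
      (2 * (β + a + √γ) + c * γ) * ∫ x in (-π)..π, cos x * exp (-c * v x) := by
  have hu : ∀ x, HasDerivAt v (deriv v x) x := fun x =>
    (hC2.differentiable (by norm_num) x).hasDerivAt
  have hcv : Continuous v := hC2.continuous
  have hcu : Continuous (deriv v) := hC2.continuous_deriv (by norm_num)
  have hw : ∀ x, HasDerivAt (fun x => exp (-c * v x)) (exp (-c * v x) * (-c * deriv v x)) x :=
    fun x => ((hu x).const_mul (-c)).exp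
  have hint : ∀ g : ℝ → ℝ, Continuous g → IntervalIntegrable g volume (-π) π :=
    fun g hg => hg.intervalIntegrable _ _
  have hcw : Continuous fun x => exp (-c * v x) := by fun_prop
  have hpi : -π ≤ π := by linarith [pi_pos]
  set L := γ / (β + a + √γ) with hL
  have hB : 0 < β + a + √γ := by positivity
  have hL0 : 0 < L := by positivity
  have hLB : L * (β + a + √γ) = γ := by rw [hL]; field_simp
  have hsign := fun x (hx : x ∈ Set.Icc (-π) π) =>
    sin_sq_le_deriv_mul_sin hβ ha hγ hper hC2 hODE hx
  -- integration by parts against `sin` and `sin * cos`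
  have e1 : ∫ x in (-π)..π,
      (cos x * exp (-c * v x) - c * (sin x * deriv v x * exp (-c * v x))) = 0 := by
    rw [intervalIntegral.integral_eq_sub_of_hasDerivAt (f := fun x => sin x * exp (-c * v x))
      (fun x _ => ((hasDerivAt_sin x).mul (hw x)).congr_deriv (by ring))
      (hint _ (by fun_prop))]
    simp
  have e2 : ∫ x in (-π)..π,
      ((1 - 2 * sin x ^ 2) * exp (-c * v x)
        - c * (cos x * (sin x * deriv v x) * exp (-c * v x))) = 0 := by
    rw [intervalIntegral.integral_eq_sub_of_hasDerivAt
      (f := fun x => sin x * cos x * exp (-c * v x))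
      (fun x _ => (((hasDerivAt_sin x).mul (hasDerivAt_cos x)).mul (hw x)).congr_deriv (by
        simp only [Pi.mul_apply]
        linear_combination (exp (-c * v x)) * (sin_sq_add_cos_sq x)))
      (hint _ (by fun_prop))]
    simp
  have i1 : ∫ x in (-π)..π, (c * L * (sin x ^ 2 * exp (-c * v x))) ≤
      ∫ x in (-π)..π, cos x * exp (-c * v x) := by
    rw [intervalIntegral.integral_sub (hint _ (by fun_prop)) (hint _ (by fun_prop)),
      sub_eq_zero] at e1
    rw [e1]
    refine intervalIntegral.integral_mono_on hpi (hint _ (by fun_prop)) (hint _ (by fun_prop))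
      fun x hx => ?_
    have := mul_le_mul_of_nonneg_left (mul_le_mul_of_nonneg_right (hsign x hx)
      (exp_pos (-c * v x)).le) hc.le
    linarith
  have i2 : ∫ x in (-π)..π, (1 - 2 * sin x ^ 2) * exp (-c * v x) ≤
      ∫ x in (-π)..π, cos x * exp (-c * v x) := by
    rw [intervalIntegral.integral_sub (hint _ (by fun_prop)) (hint _ (by fun_prop)),
      sub_eq_zero] at e1 e2
    rw [e1, e2]
    refine intervalIntegral.integral_mono_on hpi (hint _ (by fun_prop)) (hint _ (by fun_prop))
      fun x hx => ?_
    have h1 : 0 ≤ sin x * deriv v x := le_trans (by positivity) (hsign x hx)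
    have h2 := mul_le_mul_of_nonneg_right (cos_le_one x) h1
    rw [one_mul] at h2
    exact mul_le_mul_of_nonneg_left (mul_le_mul_of_nonneg_right h2 (exp_pos _).le) hc.le
  have e3 : ∫ x in (-π)..π, (1 - 2 * sin x ^ 2) * exp (-c * v x) =
      (∫ x in (-π)..π, exp (-c * v x)) - 2 * ∫ x in (-π)..π, sin x ^ 2 * exp (-c * v x) := by
    rw [← intervalIntegral.integral_const_mul, ← intervalIntegral.integral_sub
      (hint _ (by fun_prop)) (hint _ (by fun_prop))]
    congr 1
    ext x
    ring
  rw [intervalIntegral.integral_const_mul] at i1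
  rw [e3] at i2
  set A := ∫ x in (-π)..π, cos x * exp (-c * v x)
  set S := ∫ x in (-π)..π, sin x ^ 2 * exp (-c * v x)
  set W := ∫ x in (-π)..π, exp (-c * v x)
  have h1 : c * L * (W - A) ≤ 2 * A := by
    nlinarith [mul_le_mul_of_nonneg_left i2 (by positivity : 0 ≤ c * L)]
  have h2 := mul_le_mul_of_nonneg_right h1 hB.le
  have h3 : c * L * (W - A) * (β + a + √γ) = c * γ * (W - A) := by
    linear_combination c * (W - A) * hLB
  linarith

end HamiltonJacobi

/-- Near `0` a continuous function is controlled by `1 - cos`, uniformly on `[-π, π]`. -/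
theorem exists_abs_sub_le_add_mul_one_sub_cos {f : ℝ → ℝ} (hf : Continuous f) {ε : ℝ}
    (hε : 0 < ε) :
    ∃ C, 0 ≤ C ∧ ∀ x ∈ Set.Icc (-π) π, |f x - f 0| ≤ ε + C * (1 - cos x) := by
  obtain ⟨δ, hδ, hδf⟩ := Metric.continuousAt_iff.1 (hf.continuousAt (x := 0)) ε hε
  obtain ⟨B, hB⟩ := isCompact_Icc.exists_bound_of_continuousOn (s := Set.Icc (-π) π)
    (f := fun x => f x - f 0) (by fun_prop)
  have hB0 : 0 ≤ B := (norm_nonneg _).trans (hB 0 ⟨by linarith [pi_pos], pi_pos.le⟩)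
  set η := min δ π with hη
  have hη0 : 0 < η := lt_min hδ pi_pos
  have hcos : 0 < 1 - cos η := by
    have := cos_lt_cos_of_nonneg_of_le_pi le_rfl (min_le_right δ π) hη0
    rw [cos_zero] at this
    linarith
  refine ⟨B / (1 - cos η), by positivity, fun x hx => ?_⟩
  have hx1 : 0 ≤ 1 - cos x := by linarith [cos_le_one x]
  by_cases h : |x| < δ
  · have h1 := hδf (x := x) (by simpa [Real.dist_eq] using h)
    rw [Real.dist_eq] at h1
    have : 0 ≤ B / (1 - cos η) * (1 - cos x) := by positivity
    linarith
  · have h1 : cos x ≤ cos η := by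
      rw [← cos_abs x]
      exact cos_le_cos_of_nonneg_of_le_pi hη0.le (abs_le.2 hx)
        ((min_le_left _ _).trans (not_lt.1 h))
    have h2 : B ≤ B / (1 - cos η) * (1 - cos x) := by
      rw [div_mul_eq_mul_div, le_div_iff₀ hcos]
      exact mul_le_mul_of_nonneg_left (by linarith) hB0
    have h3 := hB x hx
    rw [Real.norm_eq_abs] at h3
    linarith

/-- If `κ_n → ∞` and `γ_n > 0` is a fixed point of `F_{κ_n}` for each `n`,
then `γ_n → ∞`, and consequently `μ^{γ_n}` converges weakly to the Dirac mass at `0`. -/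
theorem kuramoto_full_synchronization
    (β σ : ℝ) (hβ : 0 < β) (hσ : 0 < σ)
    (v : ℝ → ℝ → ℝ)
    (hper : ∀ γ, 0 ≤ γ → Function.Periodic (v γ) (2 * π))
    (hC2 : ∀ γ, 0 ≤ γ → ContDiff ℝ 2 (v γ))
    (hODE : ∀ γ, 0 ≤ γ → ∀ x : ℝ,
      β * v γ x - σ ^ 2 / 2 * deriv (deriv (v γ)) x + (1 / 2) * (deriv (v γ) x) ^ 2
        = -γ * Real.cos x)
    (Z : ℝ → ℝ)
    (hZ : ∀ γ, Z γ = ∫ y in (-π)..π, Real.exp (-(2 / σ ^ 2) * v γ y))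
    (F : ℝ → ℝ → ℝ)
    (hF : ∀ κ γ, F κ γ
      = κ * (∫ x in (-π)..π, Real.cos x * Real.exp (-(2 / σ ^ 2) * v γ x)) / Z γ)
    (κn γn : ℕ → ℝ)
    (hκn : Tendsto κn atTop atTop)
    (hγn : ∀ n, 0 < γn n)
    (hfix : ∀ n, F (κn n) (γn n) = γn n) :
    Tendsto γn atTop atTop ∧
      ∀ f : ℝ → ℝ, Continuous f → Function.Periodic f (2 * π) →
        Tendsto
          (fun n : ℕ =>
            (∫ x in (-π)..π, f x * Real.exp (-(2 / σ ^ 2) * v (γn n) x)) / Z (γn n))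
          atTop (𝓝 (f 0)) := by
  have ha : 0 < σ ^ 2 / 2 := by positivity
  have hc : 0 < 2 / σ ^ 2 := by positivity
  set a := σ ^ 2 / 2
  set c := 2 / σ ^ 2
  have hcont : ∀ n, Continuous (v (γn n)) := fun n => (hC2 _ (hγn n).le).continuous
  have hcw : ∀ n, Continuous fun x => exp (-c * v (γn n) x) := fun n => by
    have := hcont n
    fun_prop
  have hpi : -π < π := by linarith [pi_pos]
  have hZpos : ∀ n, 0 < Z (γn n) := fun n => by
    rw [hZ]
    exact intervalIntegral.intervalIntegral_pos_of_pos_on ((hcw n).intervalIntegrable _ _)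
      (fun x _ => exp_pos _) hpi
  set A : ℕ → ℝ := fun n => ∫ x in (-π)..π, cos x * exp (-c * v (γn n) x) with hA
  have hbound : ∀ n, c * γn n * Z (γn n) ≤ (2 * (β + a + √(γn n)) + c * γn n) * A n := fun n => by
    rw [hZ]
    exact integral_cos_mul_exp_ge hβ ha (hγn n) (hper _ (hγn n).le) (hC2 _ (hγn n).le)
      (hODE _ (hγn n).le) hc
  have hBpos : ∀ n, 0 < β + a + √(γn n) := fun n => by positivity
  have hApos : ∀ n, 0 < A n := fun n =>
    pos_of_mul_pos_right
      ((mul_pos (mul_pos hc (hγn n)) (hZpos n)).trans_le (hbound n))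
      (by have := hBpos n; have := hγn n; positivity)
  have hκ : ∀ n, c * κn n ≤ 2 * (β + a + √(γn n)) + c * γn n := fun n => by
    have h1 := hfix n
    rw [hF, div_eq_iff (hZpos n).ne'] at h1
    refine le_of_mul_le_mul_right ?_ (hApos n)
    have h2 := hbound n
    rw [mul_assoc, ← h1, ← mul_assoc] at h2
    exact h2
  have hγ : Tendsto γn atTop atTop := by
    rw [tendsto_atTop]
    intro M
    filter_upwards [(hκn.const_mul_atTop hc).eventually_gt_atTop
      (2 * (β + a + √M) + c * M)] with n hn
    by_contra! hlt
    have h1 := hκ n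
    have h2 := sqrt_le_sqrt hlt.le
    have h3 := mul_le_mul_of_nonneg_left hlt.le hc.le
    linarith
  refine ⟨hγ, fun f hf _ => ?_⟩
  have hAZ : ∀ n, A n ≤ Z (γn n) := fun n => by
    rw [hZ]
    have := hcw n
    refine intervalIntegral.integral_mono_on hpi.le
      (Continuous.intervalIntegrable (by fun_prop) _ _)
      (Continuous.intervalIntegrable (by fun_prop) _ _) fun x _ => ?_
    exact mul_le_of_le_one_left (exp_pos _).le (cos_le_one x)
  have hmoment : ∀ n, (Z (γn n) - A n) / Z (γn n) ≤
      2 / c * ((β + a) / γn n + 1 / √(γn n)) := fun n => by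
    have hγ0 := hγn n
    have hs : 0 < √(γn n) := sqrt_pos.2 hγ0
    have e : 2 / c * ((β + a) / γn n + 1 / √(γn n)) = 2 * (β + a + √(γn n)) / (c * γn n) := by
      have : 1 / √(γn n) = √(γn n) / γn n := by
        rw [div_eq_div_iff hs.ne' hγ0.ne', one_mul, mul_self_sqrt hγ0.le]
      rw [this]
      field_simp
    rw [e, div_le_div_iff₀ (hZpos n) (by positivity)]
    nlinarith [hbound n, mul_le_mul_of_nonneg_left (hAZ n) (hBpos n).le]
  have hlim : Tendsto (fun n => 2 / c * ((β + a) / γn n + 1 / √(γn n))) atTop (𝓝 0) := by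
    have h1 := hγ.const_div_atTop (β + a)
    have h2 := (tendsto_sqrt_atTop.comp hγ).const_div_atTop 1
    simpa using (h1.add h2).const_mul (2 / c)
  rw [Metric.tendsto_atTop']
  intro ε hε
  obtain ⟨C, hC0, hC⟩ := exists_abs_sub_le_add_mul_one_sub_cos hf (half_pos hε)
  have hev : ∀ᶠ n in atTop, C * (2 / c * ((β + a) / γn n + 1 / √(γn n))) < ε / 2 := by
    have := hlim.const_mul C
    rw [mul_zero] at this
    exact this.eventually_lt_const (half_pos hε)
  obtain ⟨N, hN⟩ := eventually_atTop.1 hev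
  refine ⟨N, fun n hn => ?_⟩
  have hw := hcw n
  have hZn := hZpos n
  have hint : ∀ g : ℝ → ℝ, Continuous g → IntervalIntegrable g volume (-π) π :=
    fun g hg => hg.intervalIntegrable _ _
  have e1 : (∫ x in (-π)..π, f x * exp (-c * v (γn n) x)) - f 0 * Z (γn n) =
      ∫ x in (-π)..π, (f x - f 0) * exp (-c * v (γn n) x) := by
    rw [hZ, ← intervalIntegral.integral_const_mul, ← intervalIntegral.integral_sub
      (hint _ (by fun_prop)) (hint _ (by fun_prop))]
    simp only [sub_mul]
  have e2 : ε / 2 * Z (γn n) + C * (Z (γn n) - A n) =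
      ∫ x in (-π)..π, (ε / 2 + C * (1 - cos x)) * exp (-c * v (γn n) x) := by
    rw [hZ, hA, ← intervalIntegral.integral_const_mul, ← intervalIntegral.integral_sub
      (hint _ (by fun_prop)) (hint _ (by fun_prop)), ← intervalIntegral.integral_const_mul,
      ← intervalIntegral.integral_add (hint _ (by fun_prop)) (hint _ (by fun_prop))]
    congr 1
    ext x
    ring
  have hle : |∫ x in (-π)..π, (f x - f 0) * exp (-c * v (γn n) x)| ≤
      ε / 2 * Z (γn n) + C * (Z (γn n) - A n) := by
    rw [e2]
    refine (intervalIntegral.abs_integral_le_integral_abs hpi.le).trans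
      (intervalIntegral.integral_mono_on hpi.le (hint _ (by fun_prop)) (hint _ (by fun_prop))
        fun x hx => ?_)
    rw [abs_mul, abs_of_pos (exp_pos _)]
    exact mul_le_mul_of_nonneg_right (hC x hx) (exp_pos _).le
  have e3 : (∫ x in (-π)..π, f x * exp (-c * v (γn n) x)) / Z (γn n) - f 0 =
      (∫ x in (-π)..π, (f x - f 0) * exp (-c * v (γn n) x)) / Z (γn n) := by
    rw [← e1]
    field_simp
  rw [Real.dist_eq, e3, abs_div, abs_of_pos hZn]
  calc _ ≤ (ε / 2 * Z (γn n) + C * (Z (γn n) - A n)) / Z (γn n) := by gcongr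
    _ = ε / 2 + C * ((Z (γn n) - A n) / Z (γn n)) := by field_simp
    _ ≤ ε / 2 + C * (2 / c * ((β + a) / γn n + 1 / √(γn n))) := by gcongr; exact hmoment n
    _ < ε := by linarith [hN n hn.le]
end

section
/- Suppose w, u : [0, 2π] → ℝ are continuous, w is a viscosity subsolution and u is a viscosity supersolution of the Eikonal equation (1/2)(w'(x))² = 2 sin²(x/2) on (0, 2π), and w(0) = u(0) = w(2π) = u(2π) = 0. Then w(x) ≤ u(x) for all x ∈ [0, 2π]. -/
open Real MeasureTheory Filter Topology

/-- `w` is a viscosity subsolution of the Eikonal equation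
`(1/2)(w')² = 2 sin²(x/2)` on `(0, 2π)`. -/
def IsViscSubsolutionEikonal (w : ℝ → ℝ) : Prop :=
  ∀ x₀ ∈ Set.Ioo (0 : ℝ) (2 * π), ∀ φ : ℝ → ℝ,
    ContDiffOn ℝ 1 φ (Set.Ioo (0 : ℝ) (2 * π)) →
    IsLocalMaxOn (fun x => w x - φ x) (Set.Ioo (0 : ℝ) (2 * π)) x₀ →
    (1 / 2) * (deriv φ x₀) ^ 2 ≤ 2 * Real.sin (x₀ / 2) ^ 2

/-- `u` is a viscosity supersolution of the Eikonal equation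
`(1/2)(u')² = 2 sin²(x/2)` on `(0, 2π)`. -/
def IsViscSupersolutionEikonal (u : ℝ → ℝ) : Prop :=
  ∀ x₀ ∈ Set.Ioo (0 : ℝ) (2 * π), ∀ φ : ℝ → ℝ,
    ContDiffOn ℝ 1 φ (Set.Ioo (0 : ℝ) (2 * π)) →
    IsLocalMinOn (fun x => u x - φ x) (Set.Ioo (0 : ℝ) (2 * π)) x₀ →
    (1 / 2) * (deriv φ x₀) ^ 2 ≥ 2 * Real.sin (x₀ / 2) ^ 2

/-- A subsolution stays below any `C¹` strict supersolution that dominates it at the endpoints. -/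
theorem IsViscSubsolutionEikonal.le_of_strict {w φ : ℝ → ℝ}
    (hw : ContinuousOn w (Set.Icc 0 (2 * π))) (hsub : IsViscSubsolutionEikonal w)
    (hφ : ContDiff ℝ 1 φ)
    (hstrict : ∀ x ∈ Set.Ioo (0 : ℝ) (2 * π),
      2 * Real.sin (x / 2) ^ 2 < (1 / 2) * (deriv φ x) ^ 2)
    (h0 : w 0 ≤ φ 0) (h1 : w (2 * π) ≤ φ (2 * π)) :
    ∀ x ∈ Set.Icc (0 : ℝ) (2 * π), w x ≤ φ x := by
  intro x hx
  obtain ⟨z, hz, hmax⟩ := isCompact_Icc.exists_isMaxOn ⟨x, hx⟩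
    (hw.sub hφ.continuous.continuousOn)
  have hxz : w x - φ x ≤ w z - φ z := hmax hx
  rcases hz.1.eq_or_lt with rfl | hz0
  · linarith
  rcases hz.2.eq_or_lt with rfl | hz1
  · linarith
  · exact absurd (hsub z ⟨hz0, hz1⟩ φ hφ.contDiffOn
      (hmax.on_subset Set.Ioo_subset_Icc_self).localize) (hstrict z ⟨hz0, hz1⟩).not_ge

/-- A supersolution stays above any `C¹` strict subsolution that it dominates at the endpoints. -/
theorem IsViscSupersolutionEikonal.le_of_strict {u φ : ℝ → ℝ}
    (hu : ContinuousOn u (Set.Icc 0 (2 * π))) (hsup : IsViscSupersolutionEikonal u)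
    (hφ : ContDiff ℝ 1 φ)
    (hstrict : ∀ x ∈ Set.Ioo (0 : ℝ) (2 * π),
      (1 / 2) * (deriv φ x) ^ 2 < 2 * Real.sin (x / 2) ^ 2)
    (h0 : φ 0 ≤ u 0) (h1 : φ (2 * π) ≤ u (2 * π)) :
    ∀ x ∈ Set.Icc (0 : ℝ) (2 * π), φ x ≤ u x := by
  intro x hx
  obtain ⟨z, hz, hmin⟩ := isCompact_Icc.exists_isMinOn ⟨x, hx⟩
    (hu.sub hφ.continuous.continuousOn)
  have hxz : u z - φ z ≤ u x - φ x := hmin hx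
  rcases hz.1.eq_or_lt with rfl | hz0
  · linarith
  rcases hz.2.eq_or_lt with rfl | hz1
  · linarith
  · exact absurd (hsup z ⟨hz0, hz1⟩ φ hφ.contDiffOn
      (hmin.on_subset Set.Ioo_subset_Icc_self).localize) (hstrict z ⟨hz0, hz1⟩).not_ge

theorem hasDerivAt_cos_half (x : ℝ) :
    HasDerivAt (fun y : ℝ => Real.cos (y / 2)) (-Real.sin (x / 2) * (1 / 2)) x :=
  ((hasDerivAt_id x).div_const 2).cos

theorem sin_half_pos {x : ℝ} (hx : x ∈ Set.Ioo (0 : ℝ) (2 * π)) : 0 < Real.sin (x / 2) :=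
  Real.sin_pos_of_pos_of_lt_pi (by linarith [hx.1]) (by linarith [hx.2])

theorem cos_half_two_pi : Real.cos (2 * π / 2) = -1 := by
  rw [mul_div_cancel_left₀ π two_ne_zero, Real.cos_pi]

/-- The barrier `4 (1 - σ cos (x / 2))`, with `σ = ±1`, lies above every subsolution that is
nonpositive at the endpoints. -/
theorem IsViscSubsolutionEikonal.le_barrier {w : ℝ → ℝ}
    (hw : ContinuousOn w (Set.Icc 0 (2 * π))) (hsub : IsViscSubsolutionEikonal w)
    (h0 : w 0 ≤ 0) (h1 : w (2 * π) ≤ 0) {σ : ℝ} (hσ : σ ^ 2 = 1) {x : ℝ}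
    (hx : x ∈ Set.Icc (0 : ℝ) (2 * π)) : w x ≤ 4 * (1 - σ * Real.cos (x / 2)) := by
  have hσ1 : |σ| ≤ 1 := (sq_le_one_iff_abs_le_one σ).1 hσ.le
  obtain ⟨hσl, hσu⟩ := abs_le.1 hσ1
  refine le_of_forall_pos_le_add fun ε hε => ?_
  have key := hsub.le_of_strict (φ := fun y => 4 * (1 + ε / 8) * (1 - σ * Real.cos (y / 2)))
    hw (by fun_prop) (fun y hy => ?_) ?_ ?_ x hx
  · have hc : |σ * Real.cos (x / 2)| ≤ 1 := by
      rw [abs_mul]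
      exact mul_le_one₀ hσ1 (abs_nonneg _) (Real.abs_cos_le_one _)
    have := (abs_le.1 hc).1
    nlinarith
  · have hd := (((hasDerivAt_cos_half y).const_mul σ).const_sub 1).const_mul (4 * (1 + ε / 8))
    have hs := pow_pos (sin_half_pos hy) 2
    have he : (1 / 2) * (4 * (1 + ε / 8) * -(σ * (-Real.sin (y / 2) * (1 / 2)))) ^ 2
        = 2 * (1 + ε / 8) ^ 2 * Real.sin (y / 2) ^ 2 := by
      linear_combination 2 * (1 + ε / 8) ^ 2 * Real.sin (y / 2) ^ 2 * hσ
    rw [hd.deriv, he]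
    nlinarith [mul_pos hε hs, mul_pos (mul_pos hε hε) hs]
  · simp only [zero_div, Real.cos_zero]
    exact h0.trans (mul_nonneg (by positivity) (by linarith))
  · simp only [cos_half_two_pi]
    exact h1.trans (mul_nonneg (by positivity) (by linarith))

/-- The barrier `4 (1 - |cos (x / 2)|)` lies below every supersolution that is nonnegative at the
endpoints. -/
theorem IsViscSupersolutionEikonal.barrier_le {u : ℝ → ℝ}
    (hu : ContinuousOn u (Set.Icc 0 (2 * π))) (hsup : IsViscSupersolutionEikonal u)
    (h0 : 0 ≤ u 0) (h1 : 0 ≤ u (2 * π)) {x : ℝ}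
    (hx : x ∈ Set.Icc (0 : ℝ) (2 * π)) : 4 * (1 - |Real.cos (x / 2)|) ≤ u x := by
  refine le_of_forall_pos_le_add fun ε hε => ?_
  have hpos : ∀ y : ℝ, 0 < Real.cos (y / 2) ^ 2 + (ε / 4) ^ 2 := fun y => by positivity
  have key := hsup.le_of_strict
    (φ := fun y => 4 * (√(1 + (ε / 4) ^ 2) - √(Real.cos (y / 2) ^ 2 + (ε / 4) ^ 2)))
    hu ?_ (fun y hy => ?_) ?_ ?_ x hx
  · have h1 : 1 ≤ √(1 + (ε / 4) ^ 2) := Real.one_le_sqrt.2 (by nlinarith)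
    have h2 : √(Real.cos (x / 2) ^ 2 + (ε / 4) ^ 2) ≤ |Real.cos (x / 2)| + ε / 4 := by
      refine Real.sqrt_le_iff.2 ⟨by positivity, ?_⟩
      nlinarith [sq_abs (Real.cos (x / 2)), mul_nonneg (abs_nonneg (Real.cos (x / 2))) hε.le]
    linarith
  · exact contDiff_const.mul (contDiff_const.sub
      (ContDiff.sqrt (by fun_prop) fun y => (hpos y).ne'))
  · have hd := (((((hasDerivAt_cos_half y).pow 2).add_const ((ε / 4) ^ 2)).sqrt
      (hpos y).ne').const_sub (√(1 + (ε / 4) ^ 2))).const_mul 4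
    have hs := pow_pos (sin_half_pos hy) 2
    have hr := Real.sq_sqrt (hpos y).le
    have hr0 := Real.sqrt_pos.2 (hpos y)
    refine (congrArg (fun t => (1 / 2) * t ^ 2) hd.deriv).trans_lt ?_
    set r := √(Real.cos (y / 2) ^ 2 + (ε / 4) ^ 2)
    have he : (1 / 2) * (4 * -((((2 : ℕ) : ℝ) * Real.cos (y / 2) ^ (2 - 1) *
        (-Real.sin (y / 2) * (1 / 2))) / (2 * r))) ^ 2
        = 2 * Real.sin (y / 2) ^ 2 * (Real.cos (y / 2) ^ 2 / r ^ 2) := by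
      field_simp
      norm_num
      ring
    have hlt : Real.cos (y / 2) ^ 2 / r ^ 2 < 1 := by
      rw [div_lt_one (by positivity), hr]
      exact lt_add_of_pos_right _ (by positivity)
    refine he.trans_lt ?_
    exact mul_lt_of_lt_one_right (by positivity) hlt
  · simpa using h0
  · simpa [cos_half_two_pi] using h1

/-- comparison. A continuous viscosity subsolution `w` and a continuous
viscosity supersolution `u` of the Eikonal equation on `(0,2π)` vanishing at the
endpoints satisfy `w ≤ u` on `[0, 2π]`. -/
theorem eikonal_comparison
    (w u : ℝ → ℝ)
    (hw : ContinuousOn w (Set.Icc 0 (2 * π)))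
    (hu : ContinuousOn u (Set.Icc 0 (2 * π)))
    (hsub : IsViscSubsolutionEikonal w)
    (hsup : IsViscSupersolutionEikonal u)
    (hw0 : w 0 = 0) (hu0 : u 0 = 0)
    (hw2 : w (2 * π) = 0) (hu2 : u (2 * π) = 0) :
    ∀ x ∈ Set.Icc (0 : ℝ) (2 * π), w x ≤ u x := by
  intro x hx
  refine le_trans ?_ (hsup.barrier_le hu hu0.ge hu2.ge hx)
  rcases abs_cases (Real.cos (x / 2)) with ⟨h, -⟩ | ⟨h, -⟩
  · simpa [h] using hsub.le_barrier hw hw0.le hw2.le (σ := 1) (by norm_num) hx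
  · simpa [h] using hsub.le_barrier hw hw0.le hw2.le (σ := -1) (by norm_num) hx
end

section
/- Let β > 0 and σ > 0. There exists γ₀ > 0 such that for every κ ≥ 2κ_c and every γ ∈ (0, γ₀), one has F_κ(γ) > γ. -/
open Real MeasureTheory Filter Topology

/-- At a global maximum of a continuous function the second derivative is nonpositive. -/
theorem deriv_deriv_nonpos_of_forall_le {f : ℝ → ℝ} (hf : Continuous f) {x₀ : ℝ}
    (hmax : ∀ x, f x ≤ f x₀) : deriv f x₀ = 0 ∧ deriv (deriv f) x₀ ≤ 0 := by
  have hloc : IsLocalMax f x₀ := Eventually.of_forall hmax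
  refine ⟨hloc.deriv_eq_zero, ?_⟩
  by_contra! hpos
  have hmin : IsLocalMin f x₀ :=
    isLocalMin_of_deriv_deriv_pos hpos hloc.deriv_eq_zero hf.continuousAt
  have hconst : f =ᶠ[𝓝 x₀] fun _ => f x₀ := by
    filter_upwards [hmin] with x hx using le_antisymm (hmax x) hx
  have h2 := hconst.deriv.deriv_eq
  simp at h2
  linarith

/-- A continuous periodic function on the real line attains its maximum. -/
theorem Function.Periodic.exists_forall_le {f : ℝ → ℝ} {T : ℝ} (hf : Continuous f)
    (hper : Function.Periodic f T) (hT : 0 < T) : ∃ x₀, ∀ x, f x ≤ f x₀ := by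
  obtain ⟨x₀, -, hx₀⟩ := isCompact_Icc.exists_isMaxOn
    (Set.nonempty_Icc.2 hT.le) hf.continuousOn
  refine ⟨x₀, fun x => ?_⟩
  obtain ⟨y, hy, hxy⟩ := hper.exists_mem_Ico₀ hT x
  rw [hxy]
  exact hx₀ (Set.Ico_subset_Icc_self hy)

/-- The maximum principle bounds the solution by the forcing. -/
theorem abs_le_of_periodic_viscous_hamilton_jacobi {β D γ : ℝ} (hβ : 0 < β) (hD : 0 < D)
    (hγ : 0 ≤ γ) {w : ℝ → ℝ} (hper : Function.Periodic w (2 * π)) (hw : Continuous w)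
    (hODE : ∀ x, β * w x - D * deriv (deriv w) x + (1 / 2) * (deriv w x) ^ 2 = -γ * cos x)
    (x : ℝ) : |w x| ≤ γ / β := by
  have habs : |w x| * β = |β * w x| := by rw [abs_mul, abs_of_pos hβ, mul_comm]
  rw [le_div_iff₀ hβ, habs, abs_le]
  obtain ⟨a, ha⟩ := hper.exists_forall_le hw two_pi_pos
  obtain ⟨ha1, ha2⟩ := deriv_deriv_nonpos_of_forall_le hw ha
  have hneg : Function.Periodic (-w) (2 * π) := fun y => by simp [hper y]
  obtain ⟨b, hb⟩ := hneg.exists_forall_le hw.neg two_pi_pos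
  obtain ⟨hb1, hb2⟩ := deriv_deriv_nonpos_of_forall_le hw.neg hb
  have hderiv : deriv (-w) = -deriv w := funext fun y => deriv.neg
  rw [hderiv] at hb1 hb2
  rw [deriv.neg] at hb2
  simp only [Pi.neg_apply, neg_eq_zero] at hb1 hb
  have h1 := hODE a
  have h2 := hODE b
  rw [ha1] at h1
  rw [hb1] at h2
  have h3 := mul_le_mul_of_nonneg_left (ha x) hβ.le
  have h4 := mul_le_mul_of_nonneg_left (neg_le_neg_iff.1 (hb x)) hβ.le
  constructor
  · nlinarith [mul_le_mul_of_nonneg_left (cos_le_one b) hγ, mul_nonneg hD.le (neg_nonneg.2 hb2)]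
  · nlinarith [mul_le_mul_of_nonneg_left (neg_one_le_cos a) hγ,
      mul_nonneg hD.le (neg_nonneg.2 ha2)]

/-- Integration by parts over a period: the boundary terms cancel. -/
theorem integral_mul_deriv_deriv_of_periodic {u w : ℝ → ℝ} (hu : ContDiff ℝ 1 u)
    (hw : ContDiff ℝ 2 w) (hpu : u π = u (-π)) (hpw : Function.Periodic w (2 * π)) :
    ∫ x in (-π)..π, u x * deriv (deriv w) x = -∫ x in (-π)..π, deriv u x * deriv w x := by
  have hw1 : ContDiff ℝ 1 (deriv w) :=
    (contDiff_succ_iff_deriv.1 (show ContDiff ℝ (1 + 1) w by norm_num; exact hw)).2.2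
  have hpd : deriv w π = deriv w (-π) := by
    have h : (fun y => w (y + 2 * π)) = w := funext hpw
    have h2 := deriv_comp_add_const w (2 * π) (-π)
    rw [h] at h2
    rw [h2]
    congr 1
    ring
  rw [intervalIntegral.integral_mul_deriv_eq_deriv_mul
    (fun x _ => (hu.differentiable one_ne_zero x).hasDerivAt)
    (fun x _ => (hw1.differentiable one_ne_zero x).hasDerivAt)
    ((hu.continuous_deriv le_rfl).intervalIntegrable _ _)
    ((hw1.continuous_deriv le_rfl).intervalIntegrable _ _), hpd, hpu]
  ring

theorem integral_cos_sq_period : ∫ x in (-π)..π, cos x ^ 2 = π := by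
  rw [integral_cos_sq]
  simp

/-- Testing the equation against the solution itself controls its Dirichlet energy. -/
theorem integral_deriv_sq_le {β D γ : ℝ} (hβ : 0 < β) (hγ : 0 ≤ γ)
    (hγD : γ ≤ β * D) {w : ℝ → ℝ} (hper : Function.Periodic w (2 * π)) (hw : ContDiff ℝ 2 w)
    (hODE : ∀ x, β * w x - D * deriv (deriv w) x + (1 / 2) * (deriv w x) ^ 2 = -γ * cos x)
    (hbound : ∀ x, |w x| ≤ γ / β) :
    D * ∫ x in (-π)..π, (deriv w x) ^ 2 ≤ 4 * π * (γ ^ 2 / β) := by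
  have hcw := hw.continuous
  have hcd : Continuous (deriv w) := hw.continuous_deriv (by norm_num)
  have hibp := integral_mul_deriv_deriv_of_periodic (hw.of_le (by norm_num)) hw
    (by have := hper (-π); rw [← this]; congr 1; ring) hper
  have hcdd : Continuous (fun x => w x * deriv (deriv w) x) :=
    hcw.mul ((contDiff_succ_iff_deriv.1
      (show ContDiff ℝ (1 + 1) w by norm_num; exact hw)).2.2.continuous_deriv le_rfl)
  have hmono : ∫ x in (-π)..π, (-(D / 2) * (deriv w x) ^ 2 - γ ^ 2 / β)
      ≤ ∫ x in (-π)..π, D * (w x * deriv (deriv w) x) := by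
    refine intervalIntegral.integral_mono_on (by linarith [pi_pos])
      (Continuous.intervalIntegrable (by fun_prop) _ _)
      (Continuous.intervalIntegrable (by fun_prop) _ _) fun x _ => ?_
    have hx := abs_le.1 (hbound x)
    have hwD : γ / β ≤ D := by rw [div_le_iff₀ hβ]; linarith
    have heq : D * (w x * deriv (deriv w) x)
        = β * w x ^ 2 + (1 / 2) * (w x * deriv w x ^ 2) + γ * (w x * cos x) := by
      linear_combination -(w x) * hODE x
    have h1 : -(D * deriv w x ^ 2) ≤ w x * deriv w x ^ 2 := by
      nlinarith [mul_nonneg (by linarith : 0 ≤ w x + D) (sq_nonneg (deriv w x))]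
    have h2 : -(γ / β) ≤ w x * cos x := by
      have : |w x * cos x| ≤ γ / β := by
        rw [abs_mul]
        exact (mul_le_of_le_one_right (abs_nonneg _) (abs_cos_le_one x)).trans (hbound x)
      exact (abs_le.1 this).1
    have h3 := mul_le_mul_of_nonneg_left h2 hγ
    have h4 : γ * -(γ / β) = -(γ ^ 2 / β) := by ring
    rw [heq]
    nlinarith [mul_nonneg hβ.le (sq_nonneg (w x))]
  rw [intervalIntegral.integral_sub (Continuous.intervalIntegrable (by fun_prop) _ _)
    (Continuous.intervalIntegrable (by fun_prop) _ _), intervalIntegral.integral_const_mul,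
    intervalIntegral.integral_const_mul, intervalIntegral.integral_const, hibp] at hmono
  simp only [smul_eq_mul, ← sq] at hmono
  linarith

/-- Testing the equation against the cosine. -/
theorem integral_mul_cos_le {β D γ : ℝ} {w : ℝ → ℝ}
    (hper : Function.Periodic w (2 * π)) (hw : ContDiff ℝ 2 w)
    (hODE : ∀ x, β * w x - D * deriv (deriv w) x + (1 / 2) * (deriv w x) ^ 2 = -γ * cos x) :
    (β + D) * ∫ x in (-π)..π, w x * cos x
      ≤ -(γ * π) + (1 / 2) * ∫ x in (-π)..π, (deriv w x) ^ 2 := by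
  have hcw := hw.continuous
  have hcd : Continuous (deriv w) := hw.continuous_deriv (by norm_num)
  have hibp := integral_mul_deriv_deriv_of_periodic (u := cos) contDiff_cos hw (by simp) hper
  have hibp2 : ∫ x in (-π)..π, sin x * deriv w x = -∫ x in (-π)..π, w x * cos x := by
    rw [intervalIntegral.integral_mul_deriv_eq_deriv_mul (fun x _ => hasDerivAt_sin x)
      (fun x _ => (hw.differentiable two_ne_zero x).hasDerivAt)
      (continuous_cos.intervalIntegrable _ _) (hcd.intervalIntegrable _ _)]
    simp [mul_comm]
  have hcc : ∫ x in (-π)..π, cos x * deriv (deriv w) x = -∫ x in (-π)..π, w x * cos x := by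
    rw [hibp, ← hibp2, ← intervalIntegral.integral_neg]
    simp
  have hcdd : Continuous (fun x => cos x * deriv (deriv w) x) :=
    continuous_cos.mul ((contDiff_succ_iff_deriv.1
      (show ContDiff ℝ (1 + 1) w by norm_num; exact hw)).2.2.continuous_deriv le_rfl)
  have hmono : ∫ x in (-π)..π, (β * (w x * cos x) - (1 / 2) * deriv w x ^ 2 + γ * cos x ^ 2)
      ≤ ∫ x in (-π)..π, D * (cos x * deriv (deriv w) x) := by
    refine intervalIntegral.integral_mono_on (by linarith [pi_pos])
      (Continuous.intervalIntegrable (by fun_prop) _ _)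
      (Continuous.intervalIntegrable (by fun_prop) _ _) fun x _ => ?_
    have heq : D * (cos x * deriv (deriv w) x)
        = β * (w x * cos x) + (1 / 2) * (deriv w x ^ 2 * cos x) + γ * cos x ^ 2 := by
      linear_combination -(cos x) * hODE x
    rw [heq]
    nlinarith [mul_nonneg (sq_nonneg (deriv w x)) (by linarith [neg_one_le_cos x] : 0 ≤ cos x + 1)]
  rw [intervalIntegral.integral_add (Continuous.intervalIntegrable (by fun_prop) _ _)
    (Continuous.intervalIntegrable (by fun_prop) _ _),
    intervalIntegral.integral_sub (Continuous.intervalIntegrable (by fun_prop) _ _)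
    (Continuous.intervalIntegrable (by fun_prop) _ _), intervalIntegral.integral_const_mul,
    intervalIntegral.integral_const_mul, intervalIntegral.integral_const_mul,
    intervalIntegral.integral_const_mul, integral_cos_sq_period, hcc] at hmono
  linarith

theorem integral_exp_le {w : ℝ → ℝ} (hw : Continuous w) {ε : ℝ} (hε : ε ≤ 1)
    (hbound : ∀ x, |w x| ≤ ε) : ∫ x in (-π)..π, exp (-w x) ≤ 2 * π * (1 + 2 * ε) := by
  have hmono : ∫ x in (-π)..π, exp (-w x) ≤ ∫ _ in (-π)..π, (1 + 2 * ε) := by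
    refine intervalIntegral.integral_mono_on (by linarith [pi_pos])
      (Continuous.intervalIntegrable (by fun_prop) _ _)
      (Continuous.intervalIntegrable (by fun_prop) _ _) fun x _ => ?_
    have h1 := abs_exp_sub_one_le (x := -w x) (by rw [abs_neg]; exact (hbound x).trans hε)
    rw [abs_neg] at h1
    linarith [(abs_le.1 h1).2, hbound x]
  rw [intervalIntegral.integral_const, smul_eq_mul] at hmono
  linarith

theorem le_integral_cos_mul_exp {w : ℝ → ℝ} (hw : Continuous w) {ε : ℝ} (hε : ε ≤ 1)
    (hbound : ∀ x, |w x| ≤ ε) :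
    -(∫ x in (-π)..π, w x * cos x) - 2 * π * ε ^ 2 ≤ ∫ x in (-π)..π, cos x * exp (-w x) := by
  have hmono : ∫ x in (-π)..π, (cos x - w x * cos x - ε ^ 2)
      ≤ ∫ x in (-π)..π, cos x * exp (-w x) := by
    refine intervalIntegral.integral_mono_on (by linarith [pi_pos])
      (Continuous.intervalIntegrable (by fun_prop) _ _)
      (Continuous.intervalIntegrable (by fun_prop) _ _) fun x _ => ?_
    have h1 := abs_exp_sub_one_sub_id_le (x := -w x)
      (by rw [abs_neg]; exact (hbound x).trans hε)
    have h2 : |cos x * (exp (-w x) - 1 - -w x)| ≤ (-w x) ^ 2 := by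
      rw [abs_mul]
      exact (mul_le_of_le_one_left (abs_nonneg _) (abs_cos_le_one x)).trans h1
    have h3 : (-w x) ^ 2 ≤ ε ^ 2 := by
      rw [← sq_abs, abs_neg]
      exact pow_le_pow_left₀ (abs_nonneg _) (hbound x) 2
    linarith [(abs_le.1 h2).1]
  rw [intervalIntegral.integral_sub (Continuous.intervalIntegrable (by fun_prop) _ _)
    (Continuous.intervalIntegrable (by fun_prop) _ _),
    intervalIntegral.integral_sub (Continuous.intervalIntegrable (by fun_prop) _ _)
    (Continuous.intervalIntegrable (by fun_prop) _ _), intervalIntegral.integral_const,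
    integral_cos, smul_eq_mul] at hmono
  simp only [sin_pi, sin_neg] at hmono
  linarith

/-- There exists `γ₀ > 0` such that `F_κ(γ) > γ` for every
`κ ≥ 2κ_c` and every `γ ∈ (0, γ₀)`. -/
theorem kuramoto_F_above_diagonal_near_zero
    (β σ : ℝ) (hβ : 0 < β) (hσ : 0 < σ)
    (v : ℝ → ℝ → ℝ)
    (hper : ∀ γ, 0 ≤ γ → Function.Periodic (v γ) (2 * π))
    (hC2 : ∀ γ, 0 ≤ γ → ContDiff ℝ 2 (v γ))
    (hODE : ∀ γ, 0 ≤ γ → ∀ x : ℝ,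
      β * v γ x - σ ^ 2 / 2 * deriv (deriv (v γ)) x + (1 / 2) * (deriv (v γ) x) ^ 2
        = -γ * Real.cos x)
    (Z : ℝ → ℝ)
    (hZ : ∀ γ, Z γ = ∫ y in (-π)..π, Real.exp (-(2 / σ ^ 2) * v γ y))
    (F : ℝ → ℝ → ℝ)
    (hF : ∀ κ γ, F κ γ
      = κ * (∫ x in (-π)..π, Real.cos x * Real.exp (-(2 / σ ^ 2) * v γ x)) / Z γ) :
    ∃ γ₀ > (0 : ℝ), ∀ κ : ℝ, 2 * (β * σ ^ 2 + σ ^ 4 / 2) ≤ κ →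
      ∀ γ ∈ Set.Ioo (0 : ℝ) γ₀, F κ γ > γ := by
  obtain ⟨D, hDdef⟩ : ∃ D, D = σ ^ 2 / 2 := ⟨_, rfl⟩
  have hD : 0 < D := by rw [hDdef]; positivity
  have hexp : ∀ γ x, -(2 / σ ^ 2) * v γ x = -(v γ x / D) := fun γ x => by
    rw [hDdef]; field_simp
  have hκc : 2 * (β * σ ^ 2 + σ ^ 4 / 2) = 4 * D * (β + D) := by rw [hDdef]; ring
  simp only [hexp] at hZ hF
  simp only [← hDdef] at hODE
  rw [hκc]
  refine ⟨β ^ 2 * D / (10 * (β + D)), by positivity, fun κ hκ γ ⟨hγ, hγ₀⟩ => ?_⟩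
  rw [lt_div_iff₀ (by positivity)] at hγ₀
  have hγD : γ ≤ β * D := by
    have : γ * β ≤ (β * D) * β := by nlinarith [mul_pos hγ hβ, mul_pos hγ hD]
    exact le_of_mul_le_mul_right this hβ
  have hc := (hC2 γ hγ.le).continuous
  have hb := abs_le_of_periodic_viscous_hamilton_jacobi hβ hD hγ.le (hper γ hγ.le) hc
    (hODE γ hγ.le)
  have hE := integral_deriv_sq_le hβ hγ.le hγD (hper γ hγ.le) (hC2 γ hγ.le) (hODE γ hγ.le) hb
  have hI := integral_mul_cos_le (hper γ hγ.le) (hC2 γ hγ.le) (hODE γ hγ.le)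
  have hb' : ∀ x, |v γ x / D| ≤ γ / β / D := fun x => by
    rw [abs_div, abs_of_pos hD]
    exact div_le_div_of_nonneg_right (hb x) hD.le
  have hε : γ / β / D ≤ 1 := by
    rw [div_div, div_le_one (by positivity)]
    exact hγD
  have hZle := integral_exp_le (hc.div_const D) hε hb'
  have hN := le_integral_cos_mul_exp (hc.div_const D) hε hb'
  have hZpos : 0 < ∫ x in (-π)..π, exp (-(v γ x / D)) :=
    intervalIntegral.intervalIntegral_pos_of_pos
      (Continuous.intervalIntegrable (by fun_prop) _ _) (fun _ => exp_pos _)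
      (by linarith [pi_pos])
  have hscale : ∫ x in (-π)..π, v γ x / D * cos x = (∫ x in (-π)..π, v γ x * cos x) / D := by
    rw [← intervalIntegral.integral_div]
    congr 1
    funext x
    ring
  rw [hscale] at hN
  rw [gt_iff_lt, hF, hZ, lt_div_iff₀ hZpos]
  generalize (∫ x in (-π)..π, exp (-(v γ x / D))) = Zγ at *
  generalize (∫ x in (-π)..π, cos x * exp (-(v γ x / D))) = N at *
  generalize (∫ x in (-π)..π, v γ x * cos x) = I at *
  generalize (∫ x in (-π)..π, deriv (v γ) x ^ 2) = E at *
  have hmain : γ * (2 * π * (1 + 2 * (γ / β / D))) < 4 * D * (β + D) * N := by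
    have h1 : 4 * D * (β + D) * (-(I / D) - 2 * π * (γ / β / D) ^ 2) ≤ 4 * D * (β + D) * N :=
      mul_le_mul_of_nonneg_left hN (by positivity)
    have h2 : 4 * D * (β + D) * (-(I / D) - 2 * π * (γ / β / D) ^ 2)
        = -(4 * ((β + D) * I)) - 8 * π * (β + D) * γ ^ 2 / (β ^ 2 * D) := by
      field_simp
      ring
    have h3 : E ≤ 4 * π * γ ^ 2 / (β * D) := by
      rw [le_div_iff₀ (by positivity)]
      have := mul_le_mul_of_nonneg_left hE hβ.le
      have h4 : β * (4 * π * (γ ^ 2 / β)) = 4 * π * γ ^ 2 := by field_simp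
      linarith
    have h5 : γ * (2 * π * (1 + 2 * (γ / β / D)))
        < 4 * (γ * π) - 2 * (4 * π * γ ^ 2 / (β * D))
          - 8 * π * (β + D) * γ ^ 2 / (β ^ 2 * D) := by
      rw [← sub_pos]
      have h6 : 4 * (γ * π) - 2 * (4 * π * γ ^ 2 / (β * D))
          - 8 * π * (β + D) * γ ^ 2 / (β ^ 2 * D) - γ * (2 * π * (1 + 2 * (γ / β / D)))
          = 2 * π * γ * (β ^ 2 * D - γ * (6 * β + 4 * (β + D))) / (β ^ 2 * D) := by
        field_simp
        ring
      rw [h6]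
      have h7 : 0 < β ^ 2 * D - γ * (6 * β + 4 * (β + D)) := by nlinarith [mul_pos hγ hD]
      positivity
    linarith
  have hεpos : 0 ≤ γ / β / D := by positivity
  have hNpos : 0 < N := by
    have h0 : 0 < 4 * D * (β + D) * N := lt_of_le_of_lt (by positivity) hmain
    exact pos_of_mul_pos_right h0 (by positivity)
  calc γ * Zγ ≤ γ * (2 * π * (1 + 2 * (γ / β / D))) := mul_le_mul_of_nonneg_left hZle hγ.le
    _ < 4 * D * (β + D) * N := hmain
    _ ≤ κ * N := mul_le_mul_of_nonneg_right hκ hNpos.le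
end

section
/- Let β > 0, σ > 0 and γ ≥ 0. Then v^γ(x) ≥ −γ/β for all x ∈ ℝ; equivalently, for γ > 0 the scaled function w^γ(x) := (v^γ(x) + γ/β)/√γ satisfies 0 ≤ w^γ(x) ≤ x²/2 + σ²/(2β) for all x ∈ [−π, π]. -/
open Real MeasureTheory Filter Topology

/-- The second derivative is nonpositive at a local maximum. -/
lemma IsLocalMax.deriv_deriv_nonpos {f : ℝ → ℝ} {a : ℝ} (h : IsLocalMax f a)
    (hf : ContinuousAt f a) : deriv (deriv f) a ≤ 0 := by
  by_contra! hpos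
  have hmin : IsLocalMin f a := isLocalMin_of_deriv_deriv_pos hpos h.deriv_eq_zero hf
  have hconst : f =ᶠ[𝓝 a] fun _ => f a := by
    filter_upwards [h, hmin] with x hx hx' using le_antisymm hx hx'
  have hzero : deriv (deriv f) a = 0 := by
    rw [hconst.deriv.deriv_eq]
    simp
  exact hpos.ne' hzero

/-- A continuous `2π`-periodic function minus a nonnegative multiple of `x ^ 2` attains its
maximum on `ℝ`. -/
lemma Function.Periodic.exists_forall_sub_sq_le {f : ℝ → ℝ} (hf : Function.Periodic f (2 * π))
    (hc : Continuous f) {c : ℝ} (hc0 : 0 ≤ c) :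
    ∃ a, ∀ x, f x - c * x ^ 2 ≤ f a - c * a ^ 2 := by
  obtain ⟨a, -, ha⟩ := (isCompact_Icc (a := -π) (b := π)).exists_isMaxOn
    ⟨0, by simp [pi_pos.le]⟩ (f := fun x => f x - c * x ^ 2) (by fun_prop)
  refine ⟨a, fun x => ?_⟩
  by_cases hx : x ∈ Set.Icc (-π) π
  · exact ha hx
  · obtain ⟨y, hy, hxy⟩ := hf.exists_mem_Ico two_pi_pos x (-π)
    have hy' : y ∈ Set.Icc (-π) π := ⟨hy.1, by linarith [hy.2]⟩
    have hsq : y ^ 2 ≤ x ^ 2 := by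
      have h1 : |y| ≤ π := abs_le.2 hy'
      have h2 : π < |x| := by
        by_contra! h
        exact hx (abs_le.1 h)
      exact sq_le_sq.2 (h1.trans h2.le)
    have h3 : f y - c * y ^ 2 ≤ f a - c * a ^ 2 := ha hy'
    rw [hxy]
    linarith [mul_le_mul_of_nonneg_left hsq hc0]

/-- First and second order conditions at a global maximum of `f x - c * x ^ 2`. -/
lemma deriv_conditions_of_forall_sub_sq_le {f : ℝ → ℝ} (hf : ContDiff ℝ 2 f) {a c : ℝ}
    (h : ∀ x, f x - c * x ^ 2 ≤ f a - c * a ^ 2) :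
    deriv f a = 2 * c * a ∧ deriv (deriv f) a ≤ 2 * c := by
  have hd : Differentiable ℝ f := hf.differentiable (by norm_num)
  have hdd : Differentiable ℝ (deriv f) :=
    ((contDiff_succ_iff_deriv (n := 1)).1 hf).2.2.differentiable (by norm_num)
  have hmax : IsLocalMax (fun x => f x - c * x ^ 2) a := Eventually.of_forall h
  have h1 : deriv (fun x => f x - c * x ^ 2) = fun x => deriv f x - 2 * c * x := by
    ext x
    have := (hd x).hasDerivAt.sub ((hasDerivAt_pow 2 x).const_mul c)
    refine this.deriv.trans ?_
    norm_num
    ring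
  have h2 : deriv (fun x => deriv f x - 2 * c * x) a = deriv (deriv f) a - 2 * c := by
    have := (hdd a).hasDerivAt.sub ((hasDerivAt_id a).const_mul (2 * c))
    exact this.deriv.trans (by ring)
  have h3 := hmax.deriv_eq_zero
  have h4 := hmax.deriv_deriv_nonpos (by have := hd.continuous; fun_prop)
  rw [h1] at h3 h4
  rw [h2] at h4
  exact ⟨by linarith, by linarith⟩

/-- lower bound. For every `γ ≥ 0`, `v^γ ≥ −γ/β` on `ℝ`;
equivalently, for `γ > 0` the scaled function `w^γ(x) = (v^γ(x) + γ/β)/√γ` satisfies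
`0 ≤ w^γ(x) ≤ x²/2 + σ²/(2β)` on `[−π, π]`. -/
theorem kuramoto_value_lower_bound
    (β σ : ℝ) (hβ : 0 < β) (hσ : 0 < σ)
    (v : ℝ → ℝ → ℝ)
    (hper : ∀ γ, 0 ≤ γ → Function.Periodic (v γ) (2 * π))
    (hC2 : ∀ γ, 0 ≤ γ → ContDiff ℝ 2 (v γ))
    (hODE : ∀ γ, 0 ≤ γ → ∀ x : ℝ,
      β * v γ x - σ ^ 2 / 2 * deriv (deriv (v γ)) x + (1 / 2) * (deriv (v γ) x) ^ 2
        = -γ * Real.cos x)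
    (γ : ℝ) (hγ : 0 ≤ γ) :
    (∀ x : ℝ, -(γ / β) ≤ v γ x) ∧
    (0 < γ → ∀ x ∈ Set.Icc (-π) π,
      0 ≤ (v γ x + γ / β) / Real.sqrt γ ∧
      (v γ x + γ / β) / Real.sqrt γ ≤ x ^ 2 / 2 + σ ^ 2 / (2 * β)) := by
  have hv := hC2 γ hγ
  have hp := hper γ hγ
  have hode := hODE γ hγ
  have hlow : ∀ x : ℝ, -(γ / β) ≤ v γ x := by
    intro x
    obtain ⟨a, ha⟩ := Function.Periodic.exists_forall_sub_sq_le (f := fun x => -v γ x)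
      (fun x => congrArg Neg.neg (hp x)) hv.continuous.neg le_rfl
    obtain ⟨h1, h2⟩ := deriv_conditions_of_forall_sub_sq_le hv.neg ha
    have hd : deriv (fun x => -v γ x) = fun x => -deriv (v γ) x := by
      ext x
      exact deriv.fun_neg
    rw [hd] at h1 h2
    rw [deriv.fun_neg] at h2
    have h3 : deriv (v γ) a = 0 := by linarith
    have h4 : 0 ≤ σ ^ 2 / 2 * deriv (deriv (v γ)) a := mul_nonneg (by positivity) (by linarith)
    have h5 := hode a
    rw [h3] at h5
    have h6 : γ * cos a ≤ γ * 1 := mul_le_mul_of_nonneg_left (cos_le_one a) hγ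
    have h7 : -γ / β ≤ v γ a := by
      rw [div_le_iff₀ hβ]
      linarith
    have h8 := ha x
    rw [← neg_div]
    linarith
  refine ⟨hlow, fun hpos x _ => ⟨div_nonneg (by linarith [hlow x]) (sqrt_nonneg _), ?_⟩⟩
  have hs : 0 < √γ := sqrt_pos.2 hpos
  have hss : √γ ^ 2 = γ := sq_sqrt hγ
  obtain ⟨a, ha⟩ := hp.exists_forall_sub_sq_le hv.continuous (c := √γ / 2) (by positivity)
  obtain ⟨h1, h2⟩ := deriv_conditions_of_forall_sub_sq_le hv ha
  have h3 := hode a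
  rw [h1] at h3
  have h4 : σ ^ 2 / 2 * deriv (deriv (v γ)) a ≤ σ ^ 2 / 2 * (2 * (√γ / 2)) :=
    mul_le_mul_of_nonneg_left h2 (by positivity)
  have h5 : γ * (1 - a ^ 2 / 2) ≤ γ * cos a :=
    mul_le_mul_of_nonneg_left (one_sub_sq_div_two_le_cos) hγ
  have h6 : (2 * (√γ / 2) * a) ^ 2 = γ * a ^ 2 := by
    rw [← hss]
    ring_nf
    simp
  have h7 : β * v γ a ≤ σ ^ 2 / 2 * √γ - γ := by
    rw [h6] at h3
    linarith
  have h8 : v γ a ≤ (σ ^ 2 / 2 * √γ - γ) / β := by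
    rw [le_div_iff₀ hβ]
    linarith
  have h9 : (σ ^ 2 / 2 * √γ - γ) / β = σ ^ 2 / (2 * β) * √γ - γ / β := by
    field_simp
  have h10 : 0 ≤ √γ / 2 * a ^ 2 := by positivity
  rw [div_le_iff₀ hs]
  linarith [ha x]
end
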